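/- arXiv:2010.00138 — 2 statements merged into one kernel-verified Lean document; each statement's English description precedes it below -/
import Mathlib

section
/- Let I be a minimization instance of the DTSPMS on V = {0,1,...,n} with k rows of capacity c ≥ ⌈n/k⌉ in which d_P and d_D are nonnegative and satisfy the triangle inequality, and let ρ ≥ 1. If a tour T satisfies d_Σ(T) ≤ ρ·OPT(I_Σ), then the feasible pair (T, T^-) has value d_P(T) + d_D(T^-) = d_Σ(T) ≤ k·ρ·OPT(I), where OPT(I) is the minimum value over feasible pairs and OPT(I_Σ) is the minimum of d_Σ over tours, with d_Σ(i,j) = d_P(i,j) + d_D(j,i). -/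
open Finset

/-- A tour on `V = {0,1,...,n}` (`0` is the depot) is encoded by a permutation `σ` of
`Fin n`: the item visited at position `p+1` is `σ p` (items `1,...,n` are encoded as
`Fin n` and embedded in `V = Fin (n+1)` via `Fin.succ`). `tourSeq σ q` is the vertex
visited at position `q` of the cycle (position `0` is the depot). -/
def tourSeq {n : ℕ} (σ : Equiv.Perm (Fin n)) (q : Fin (n + 1)) : Fin (n + 1) :=
  if h : q = 0 then 0 else (σ (q.pred h)).succ

/-- Value of a tour: the sum of `d` over its `n+1` consecutive ordered pairs. -/
def tourValue {n : ℕ} (d : Fin (n + 1) → Fin (n + 1) → ℚ) (σ : Equiv.Perm (Fin n)) : ℚ :=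
  ∑ q : Fin (n + 1), d (tourSeq σ q) (tourSeq σ (q + 1))

/-- The reverse tour `T⁻`. -/
def revTour {n : ℕ} (σ : Equiv.Perm (Fin n)) : Equiv.Perm (Fin n) :=
  Fin.revPerm.trans σ

/-- Tour `σ` visits item `i` before item `j`. -/
def visitsBefore {n : ℕ} (σ : Equiv.Perm (Fin n)) (i j : Fin n) : Prop :=
  σ.symm i < σ.symm j

/-- A loading plan with `k` rows, each of capacity `c`: every fiber has size at most `c`. -/
def IsLoadingPlan {n : ℕ} (k c : ℕ) (f : Fin n → Fin k) : Prop :=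
  ∀ r : Fin k, (Finset.univ.filter fun i => f i = r).card ≤ c

/-- The pair of tours `(σP, σD)` is consistent with the loading plan `f`: items loaded in
the same row are visited in opposite orders by the two tours. -/
def FeasibleFor {n k : ℕ} (f : Fin n → Fin k) (σP σD : Equiv.Perm (Fin n)) : Prop :=
  ∀ i j : Fin n, i ≠ j → f i = f j → (visitsBefore σP i j ↔ visitsBefore σD j i)

/-- `(σP, σD)` is a feasible pair of pickup and delivery tours for parameters `(k, c)`. -/
def FeasiblePair {n : ℕ} (k c : ℕ) (σP σD : Equiv.Perm (Fin n)) : Prop :=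
  ∃ f : Fin n → Fin k, IsLoadingPlan k c f ∧ FeasibleFor f σP σD

/-- `d_Σ(i,j) = d_P(i,j) + d_D(j,i)`. -/
def dSigma {n : ℕ} (dP dD : Fin (n + 1) → Fin (n + 1) → ℚ) (i j : Fin (n + 1)) : ℚ :=
  dP i j + dD j i

/-- The set of values of tours under distance `d`. -/
def tourValues (n : ℕ) (d : Fin (n + 1) → Fin (n + 1) → ℚ) : Set ℚ :=
  {v | ∃ σ : Equiv.Perm (Fin n), v = tourValue d σ}

/-- The set of values of feasible pairs of pickup and delivery tours. -/
def feasibleValues (n k c : ℕ) (dP dD : Fin (n + 1) → Fin (n + 1) → ℚ) : Set ℚ :=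
  {v | ∃ σP σD : Equiv.Perm (Fin n), FeasiblePair k c σP σD ∧
        v = tourValue dP σP + tourValue dD σD}


def pv {V : Type} (d : V → V → ℚ) : V → List V → V → ℚ
  | a, [], z => d a z
  | a, b :: l, z => d a b + pv d b l z

lemma pv_snoc {V : Type} (d : V → V → ℚ) (l : List V) (a b z : V) :
    pv d a (l ++ [b]) z = pv d a l b + d b z := by
  induction l generalizing a with
  | nil => simp [pv]
  | cons x l ih => simp [pv, ih, add_assoc]

lemma pv_reverse {V : Type} (d : V → V → ℚ) (l : List V) (a z : V) :
    pv (fun i j => d j i) a l z = pv d z l.reverse a := by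
  induction l generalizing a with
  | nil => simp [pv]
  | cons x l ih => simp [pv, ih, pv_snoc, add_comm]

lemma pv_add {V : Type} (d e : V → V → ℚ) (l : List V) (a z : V) :
    pv (fun i j => d i j + e i j) a l z = pv d a l z + pv e a l z := by
  induction l generalizing a with
  | nil => simp [pv]
  | cons x l ih => simp [pv, ih]; ring

lemma pv_tri {V : Type} (d : V → V → ℚ) (h : ∀ u v w, d u v ≤ d u w + d w v)
    (l : List V) (a b z : V) : pv d a l z ≤ d a b + pv d b l z := by
  cases l with
  | nil => simpa [pv] using h _ _ _
  | cons x l => simp only [pv]; linarith [h a x b]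

lemma pv_sublist {V : Type} (d : V → V → ℚ) (h : ∀ u v w, d u v ≤ d u w + d w v)
    {l₁ l₂ : List V} (hs : l₁.Sublist l₂) (a z : V) : pv d a l₁ z ≤ pv d a l₂ z := by
  induction hs generalizing a with
  | slnil => simp
  | cons x _ ih => exact (pv_tri d h _ a x z).trans (by simp only [pv]; linarith [ih x])
  | cons_cons x _ ih => simp only [pv]; linarith [ih x]

lemma pv_append {V : Type} (d : V → V → ℚ) (h : ∀ u v w, d u v ≤ d u w + d w v)
    (l₁ l₂ : List V) (a y z : V) : pv d a (l₁ ++ l₂) z ≤ pv d a l₁ y + pv d y l₂ z := by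
  induction l₁ generalizing a with
  | nil => exact pv_tri d h _ _ _ _
  | cons x l ih => simp only [pv, List.cons_append]; linarith [ih x]

lemma pv_flatMap {V ι : Type} (d : V → V → ℚ) (h : ∀ u v w, d u v ≤ d u w + d w v)
    (z : V) (hz : d z z = 0) (L : List ι) (g : ι → List V) (B : ℚ)
    (hB : ∀ i, pv d z (g i) z ≤ B) :
    pv d z (L.flatMap g) z ≤ L.length * B := by
  induction L with
  | nil => simp [pv, hz]
  | cons x l ih =>
    simp only [List.flatMap_cons, List.length_cons]
    push_cast
    linarith [pv_append d h (g x) (l.flatMap g) z z z, hB x]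

lemma pv_ofFn {V : Type} (d : V → V → ℚ) (m : ℕ) (g : Fin m → V) (a z : V) :
    pv d a (List.ofFn g) z =
      ∑ q : Fin (m + 1), d (Fin.cons (α := fun _ => V) a g q) (Fin.snoc (α := fun _ => V) g z q) := by
  induction m generalizing a with
  | zero => simp [pv, Fin.snoc]
  | succ m ih =>
    rw [List.ofFn_succ, pv, ih, Fin.sum_univ_succ (n := m + 1)]
    congr 1
    refine Finset.sum_congr rfl fun q _ => ?_
    congr 1
    · rw [Fin.cons_succ]
      refine Fin.cases ?_ (fun i => ?_) q <;> simp
    · refine Fin.lastCases ?_ (fun i => ?_) q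
      · rw [Fin.snoc_last, Fin.succ_last, Fin.snoc_last]
      · rw [Fin.snoc_castSucc, Fin.succ_castSucc, Fin.snoc_castSucc]

lemma tourValue_eq {n : ℕ} (d : Fin (n + 1) → Fin (n + 1) → ℚ) (σ : Equiv.Perm (Fin n)) :
    tourValue d σ = pv d 0 ((List.ofFn σ).map Fin.succ) 0 := by
  rw [List.map_ofFn, pv_ofFn, tourValue]
  refine Finset.sum_congr rfl fun q _ => ?_
  congr 1
  · refine Fin.cases ?_ (fun i => ?_) q <;> simp [tourSeq]
  · refine Fin.lastCases ?_ (fun i => ?_) q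
    · simp [tourSeq]
    · simp [tourSeq, Fin.succ_ne_zero]

lemma ofFn_revTour {n : ℕ} (σ : Equiv.Perm (Fin n)) :
    List.ofFn (revTour σ) = (List.ofFn σ).reverse := by
  apply List.ext_getElem
  · simp
  · intro i h1 h2
    simp only [List.getElem_ofFn, List.getElem_reverse, revTour, Equiv.trans_apply, Fin.revPerm_apply]
    congr 1
    ext
    simp [Fin.rev]
    omega

lemma pv_dSigma {n : ℕ} (dP dD : Fin (n + 1) → Fin (n + 1) → ℚ) (l : List (Fin n)) :
    pv (dSigma dP dD) 0 (l.map Fin.succ) 0 =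
      pv dP 0 (l.map Fin.succ) 0 + pv dD 0 (l.reverse.map Fin.succ) 0 := by
  have := pv_add dP (fun i j => dD j i) (l.map Fin.succ) 0 0
  rw [pv_reverse dD, ← List.map_reverse] at this
  exact this

lemma exists_perm {n : ℕ} (L : List (Fin n)) (hL : L.Nodup) (hm : ∀ i, i ∈ L) :
    ∃ σ : Equiv.Perm (Fin n), List.ofFn σ = L := by
  have hlen : L.length = n := by
    have := Fintype.card_congr (List.Nodup.getEquivOfForallMemList L hL hm)
    simpa using this
  refine ⟨(finCongr hlen.symm).trans (List.Nodup.getEquivOfForallMemList L hL hm), ?_⟩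
  apply List.ext_getElem
  · simp [hlen]
  · intro i h1 h2
    simp [List.Nodup.getEquivOfForallMemList]

lemma pairwise_pos {n : ℕ} (σ : Equiv.Perm (Fin n)) :
    (List.ofFn σ).Pairwise (visitsBefore σ) := by
  rw [List.pairwise_ofFn]
  intro i j h
  simpa [visitsBefore] using h

lemma filter_rev {n k : ℕ} (f : Fin n → Fin k) (σP σD : Equiv.Perm (Fin n))
    (hf : FeasibleFor f σP σD) (r : Fin k) :
    ((List.ofFn σP).filter (fun i => f i = r)).reverse =
      (List.ofFn σD).filter (fun i => f i = r) := by
  have nP : (List.ofFn σP).Nodup := List.nodup_ofFn.2 σP.injective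
  have nD : (List.ofFn σD).Nodup := List.nodup_ofFn.2 σD.injective
  have hperm : ((List.ofFn σP).filter (fun i => f i = r)).reverse.Perm
      ((List.ofFn σD).filter (fun i => f i = r)) := by
    rw [List.perm_ext_iff_of_nodup (List.nodup_reverse.2 (nP.filter _)) (nD.filter _)]
    intro a
    have h1 : ∃ i, σP i = a := σP.surjective a
    have h2 : ∃ i, σD i = a := σD.surjective a
    simp [h1, h2, List.mem_ofFn]
  refine hperm.eq_of_pairwise (le := visitsBefore σD) ?_ ?_ ?_
  · intro a b _ _ h1 h2
    exact absurd (lt_trans h1 h2) (lt_irrefl _)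
  · rw [List.pairwise_reverse]
    refine (((pairwise_pos σP).filter _).imp_of_mem ?_)
    intro a b ha hb hab
    have ha' : f a = r := by simpa using (List.mem_filter.1 ha).2
    have hb' : f b = r := by simpa using (List.mem_filter.1 hb).2
    refine (hf a b ?_ (ha'.trans hb'.symm)).1 hab
    rintro rfl
    exact lt_irrefl _ hab
  · exact (pairwise_pos σD).filter _

lemma feasible_rev {n k c : ℕ} (hn : 1 ≤ n) (hk : 1 ≤ k) (hc : (n + k - 1) / k ≤ c)
    (T : Equiv.Perm (Fin n)) : FeasiblePair k c T (revTour T) := by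
  have h1 : n ≤ c * k := by
    have h2 : n + k - 1 < ((n + k - 1) / k + 1) * k := by
      rw [mul_comm]; exact Nat.lt_mul_div_succ _ hk
    have h3 : ((n + k - 1) / k + 1) * k ≤ (c + 1) * k := Nat.mul_le_mul_right _ (by omega)
    have h4 : (c + 1) * k = c * k + k := by ring
    omega
  have hc0 : 0 < c := by
    rcases Nat.eq_zero_or_pos c with h | h
    · subst h; omega
    · exact h
  refine ⟨fun i => ⟨i / c, (Nat.div_lt_iff_lt_mul hc0).2 (by have := i.2; rw [mul_comm]; omega)⟩, ?_, ?_⟩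
  · intro r
    have : (Finset.univ.filter fun i : Fin n => (⟨i / c, (Nat.div_lt_iff_lt_mul hc0).2 (by have := i.2; rw [mul_comm]; omega)⟩ : Fin k) = r).card
        ≤ (Finset.Ico (r * c : ℕ) (r * c + c)).card := by
      refine Finset.card_le_card_of_injOn (fun i => (i : ℕ)) ?_ (fun a _ b _ h => Fin.ext h)
      intro i hi
      simp only [Finset.coe_filter, Finset.mem_univ, true_and, Set.mem_setOf_eq, Fin.ext_iff] at hi
      simp only [Finset.coe_Ico, Set.mem_Ico]
      rw [← hi]
      have e1 := Nat.div_add_mod (i : ℕ) c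
      have e2 := Nat.mod_lt (i : ℕ) hc0
      rw [mul_comm] at e1
      omega
    simpa using this
  · intro i j _ _
    simp [visitsBefore, revTour]

/-- minimization, metric case. If a tour `T` satisfies
`d_Σ(T) ≤ ρ·OPT(I_Σ)`, then the feasible pair `(T, T⁻)` has value
`d_P(T) + d_D(T⁻) = d_Σ(T) ≤ k·ρ·OPT(I)`. -/
theorem stmt10 (n k c : ℕ) (hn : 1 ≤ n) (hk : 1 ≤ k) (hc : (n + k - 1) / k ≤ c)
    (dP dD : Fin (n + 1) → Fin (n + 1) → ℚ)
    (hPnn : ∀ i j, 0 ≤ dP i j) (hDnn : ∀ i j, 0 ≤ dD i j)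
    (hPdiag : ∀ i, dP i i = 0) (hDdiag : ∀ i, dD i i = 0)
    (hPtri : ∀ u v w, dP u v ≤ dP u w + dP w v)
    (hDtri : ∀ u v w, dD u v ≤ dD u w + dD w v)
    (ρ : ℚ) (hρ : 1 ≤ ρ)
    (optI optS : ℚ)
    (hoptI : IsLeast (feasibleValues n k c dP dD) optI)
    (hoptS : IsLeast (tourValues n (dSigma dP dD)) optS)
    (T : Equiv.Perm (Fin n))
    (hT : tourValue (dSigma dP dD) T ≤ ρ * optS) :
    FeasiblePair k c T (revTour T) ∧
      tourValue dP T + tourValue dD (revTour T) = tourValue (dSigma dP dD) T ∧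
      tourValue (dSigma dP dD) T ≤ k * ρ * optI := by
  have hsplit := fun l => pv_dSigma dP dD l
  refine ⟨feasible_rev hn hk hc T, ?_, ?_⟩
  · rw [tourValue_eq, tourValue_eq, tourValue_eq, ofFn_revTour, hsplit]
  obtain ⟨⟨σP, σD, ⟨f, -, hf⟩, rfl⟩, -⟩ := hoptI
  obtain ⟨σ, hσ⟩ := exists_perm
    ((List.finRange k).flatMap fun r => (List.ofFn σP).filter (fun i => f i = r))
    (by
      have nP : (List.ofFn σP).Nodup := List.nodup_ofFn.2 σP.injective
      rw [List.nodup_flatMap]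
      refine ⟨fun r _ => nP.filter _, (List.nodup_finRange k).imp ?_⟩
      intro r s hrs i hi hj
      have h1 := (List.mem_filter.1 hi).2
      have h2 := (List.mem_filter.1 hj).2
      simp at h1 h2
      exact hrs (h1.symm.trans h2))
    (by
      intro i
      have h1 : ∃ j, σP j = i := σP.surjective i
      simp [List.mem_ofFn, h1])
  have htri : ∀ u v w, dSigma dP dD u v ≤ dSigma dP dD u w + dSigma dP dD w v := by
    intro u v w
    simp only [dSigma]
    linarith [hPtri u v w, hDtri v u w]
  have key : tourValue (dSigma dP dD) σ ≤ k * (tourValue dP σP + tourValue dD σD) := by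
    rw [tourValue_eq, hσ, List.map_flatMap]
    refine (pv_flatMap _ htri 0 (by simp [dSigma, hPdiag, hDdiag]) _ _
      (tourValue dP σP + tourValue dD σD) ?_).trans (by simp)
    intro r
    rw [hsplit, filter_rev f σP σD hf, tourValue_eq, tourValue_eq]
    exact add_le_add (pv_sublist dP hPtri (List.filter_sublist.map _) _ _)
      (pv_sublist dD hDtri (List.filter_sublist.map _) _ _)
  have hS : optS ≤ tourValue (dSigma dP dD) σ := hoptS.2 ⟨σ, rfl⟩
  calc _ ≤ ρ * optS := hT
    _ ≤ ρ * (k * (tourValue dP σP + tourValue dD σD)) :=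
      mul_le_mul_of_nonneg_left (hS.trans key) (by linarith)
    _ = _ := by ring
end

section
/- Let I be a maximization instance of the DTSPMS on V = {0,1,...,n} with parameters (k, c), c ≥ ⌈n/k⌉, and let ρ ∈ [0,1]. If a tour T satisfies d_Σ(T) ≥ ρ·OPT(I_Σ) + (1 − ρ)·WOR(I_Σ), then the feasible pair (T, T^-), whose value equals d_Σ(T), satisfies d_Σ(T) ≥ (ρ/2)·OPT(I) + (1 − ρ/2)·WOR(I). Here OPT(I) and WOR(I) are the maximum and minimum values over feasible pairs, and OPT(I_Σ), WOR(I_Σ) are the maximum and minimum of d_Σ over all tours, with d_Σ(i,j) = d_P(i,j) + d_D(j,i). -/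
open Finset

theorem tourSeq_rev {n : ℕ} (σ : Equiv.Perm (Fin n)) (q : Fin (n + 1)) :
    tourSeq (revTour σ) q = tourSeq σ (-q) := by
  unfold tourSeq revTour
  by_cases h : q = 0
  · subst h; simp
  · have h' : -q ≠ 0 := by simpa using h
    rw [dif_neg h, dif_neg h']
    congr 1
    simp only [Equiv.trans_apply, Fin.revPerm_apply]
    congr 1
    apply Fin.ext
    have hq : q.val ≠ 0 := fun e => h (Fin.ext e)
    have hlt := q.isLt
    simp only [Fin.val_rev, Fin.val_pred, Fin.val_neg', Fin.neg_def]
    rw [Nat.mod_eq_of_lt (by omega)]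
    omega

theorem tourValue_rev {n : ℕ} (d : Fin (n + 1) → Fin (n + 1) → ℚ) (σ : Equiv.Perm (Fin n)) :
    tourValue d (revTour σ) = tourValue (fun i j => d j i) σ := by
  unfold tourValue
  refine Fintype.sum_equiv ((Equiv.addRight (1 : Fin (n + 1))).trans (Equiv.neg _)) _ _ ?_
  intro q
  simp [tourSeq_rev]

theorem revTour_revTour {n : ℕ} (σ : Equiv.Perm (Fin n)) : revTour (revTour σ) = σ := by
  ext i; simp [revTour]

theorem tourValue_dSigma {n : ℕ} (dP dD : Fin (n + 1) → Fin (n + 1) → ℚ)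
    (σ : Equiv.Perm (Fin n)) :
    tourValue dP σ + tourValue dD (revTour σ) = tourValue (dSigma dP dD) σ := by
  rw [tourValue_rev]
  simp [tourValue, dSigma, Finset.sum_add_distrib]

theorem visitsBefore_rev {n : ℕ} (σ : Equiv.Perm (Fin n)) (i j : Fin n) :
    visitsBefore (revTour σ) i j ↔ visitsBefore σ j i := by
  simp [visitsBefore, revTour]

theorem exists_plan (n k c : ℕ) (hn : 1 ≤ n) (hk : 1 ≤ k) (hc : (n + k - 1) / k ≤ c) :
    ∃ f : Fin n → Fin k, IsLoadingPlan k c f := by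
  have h1 : n ≤ k * c := by
    have h2 : n + k - 1 < k * ((n + k - 1) / k + 1) := Nat.lt_mul_div_succ _ (by omega)
    have h3 : k * ((n + k - 1) / k + 1) ≤ k * (c + 1) := Nat.mul_le_mul_left _ (by omega)
    have h4 : k * (c + 1) = k * c + k := by ring
    omega
  have hc0 : 0 < c := by
    rcases Nat.eq_zero_or_pos c with h | h
    · subst h; omega
    · exact h
  refine ⟨fun i => ⟨i.val / c, ?_⟩, ?_⟩
  · rw [Nat.div_lt_iff_lt_mul hc0]; have := i.isLt; omega
  · intro r
    have : (Finset.Ico (r.val * c) (r.val * c + c)).card = c := by simp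
    conv_rhs => rw [← this]
    refine Finset.card_le_card_of_injOn (fun i => i.val) ?_ (fun a _ b _ h => Fin.ext h)
    intro i hi
    simp only [Finset.coe_filter, Finset.mem_univ, true_and, Set.mem_setOf_eq, Fin.ext_iff] at hi
    simp only [Finset.coe_Ico, Set.mem_Ico]
    rw [← hi]
    have := Nat.div_add_mod i.val c
    have := Nat.mod_lt i.val hc0
    have := Nat.mul_comm c (i.val / c)
    omega

/-- maximization. If a tour `T` is `ρ`-differentially approximate for the
TSP on `I_Σ`, then the feasible pair `(T, T⁻)`, whose value equals `d_Σ(T)`, is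
`ρ/2`-differentially approximate for the DTSPMS. -/
theorem stmt17 (n k c : ℕ) (hn : 1 ≤ n) (hk : 1 ≤ k) (hc : (n + k - 1) / k ≤ c)
    (dP dD : Fin (n + 1) → Fin (n + 1) → ℚ)
    (hPnn : ∀ i j, 0 ≤ dP i j) (hDnn : ∀ i j, 0 ≤ dD i j)
    (hPdiag : ∀ i, dP i i = 0) (hDdiag : ∀ i, dD i i = 0)
    (ρ : ℚ) (hρ0 : 0 ≤ ρ) (hρ1 : ρ ≤ 1)
    (optI worI optS worS : ℚ)
    (hoptI : IsGreatest (feasibleValues n k c dP dD) optI)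
    (hworI : IsLeast (feasibleValues n k c dP dD) worI)
    (hoptS : IsGreatest (tourValues n (dSigma dP dD)) optS)
    (hworS : IsLeast (tourValues n (dSigma dP dD)) worS)
    (T : Equiv.Perm (Fin n))
    (hT : ρ * optS + (1 - ρ) * worS ≤ tourValue (dSigma dP dD) T) :
    FeasiblePair k c T (revTour T) ∧
      tourValue dP T + tourValue dD (revTour T) = tourValue (dSigma dP dD) T ∧
      ρ / 2 * optI + (1 - ρ / 2) * worI ≤ tourValue (dSigma dP dD) T := by
  have hfe : ∀ S : Equiv.Perm (Fin n), FeasiblePair k c S (revTour S) := by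
    intro S
    obtain ⟨f, hf⟩ := exists_plan n k c hn hk hc
    exact ⟨f, hf, fun i j _ _ => (visitsBefore_rev S j i).symm⟩
  refine ⟨hfe T, tourValue_dSigma dP dD T, ?_⟩
  obtain ⟨⟨P, D, ⟨f, hf, hPD⟩, rfl⟩, -⟩ := hoptI
  have h1 : worI ≤ tourValue dP (revTour D) + tourValue dD (revTour P) := by
    apply hworI.2
    refine ⟨_, _, ⟨f, hf, ?_⟩, rfl⟩
    intro i j hij hfij
    rw [visitsBefore_rev, visitsBefore_rev]
    exact (hPD i j hij hfij).symm
  have h2 : tourValue (dSigma dP dD) P ≤ optS := hoptS.2 ⟨_, rfl⟩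
  have h3 : tourValue (dSigma dP dD) (revTour D) ≤ optS := hoptS.2 ⟨_, rfl⟩
  rw [← tourValue_dSigma] at h2 h3
  rw [revTour_revTour] at h3
  have h4 : worI ≤ worS := by
    obtain ⟨⟨S, rfl⟩, -⟩ := hworS
    exact hworI.2 ⟨S, revTour S, hfe S, (tourValue_dSigma dP dD S).symm⟩
  have h5 := mul_le_mul_of_nonneg_left h4 (sub_nonneg.2 hρ1)
  have h6 : ρ * (tourValue dP P + tourValue dD D + worI) ≤ ρ * (2 * optS) :=
    mul_le_mul_of_nonneg_left (by linarith) hρ0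
  linarith
end
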